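/- arXiv:0807.1582 — 4 statements merged into one kernel-verified Lean document; each statement's English description precedes it below -/
import Mathlib

section
/- For every integer n ≥ 4 and every positive integer m there exists a nonnegative constant C = C(m,n) (depending only on m and n) such that: for every ρ ≥ 0 and all real numbers x_1, …, x_n satisfying (i) x_1 ≤ x_2 ≤ min_{3≤i≤n} x_i, (ii) S + m·M_{12} ≥ −ρ, and (iii) S + (m+1)·M_{12} < −(m+1)(m+n−1)·ρ, one has f(x_1, …, x_n) ≥ −C·ρ². -/
open Finset

/-- `M x i j = x_i + x_j`. -/
noncomputable def solM (x : ℕ → ℝ) (i j : ℕ) : ℝ := x i + x j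

/-- `S = Σ_{i<j, {i,j}≠{1,2}} M_{ij}`, indices running over `1,…,n`. -/
noncomputable def solS (n : ℕ) (x : ℕ → ℝ) : ℝ :=
  ∑ i ∈ Icc 1 n, ∑ j ∈ Icc 1 n,
    if i < j ∧ ¬(i = 1 ∧ j = 2) then solM x i j else 0

/-- The function `f` from the algebra lemma. -/
noncomputable def solf (n m : ℕ) (x : ℕ → ℝ) : ℝ :=
  -(solS n x / ((m : ℝ) + 1)) * (solS n x + ((m : ℝ) + 1) * solM x 1 2)
    - solM x 1 2 * solS n x
    + ((∑ i ∈ Icc 1 n, ∑ j ∈ Icc 1 n,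
        if i < j ∧ ¬(i = 1 ∧ j = 2) then
          (solM x i j) ^ 2 +
            ∑ k ∈ (Icc 1 n).filter (fun k => k ≠ i ∧ k ≠ j), solM x i k * solM x j k
        else 0)
      + ((m : ℝ) + 1) *
          ∑ k ∈ (Icc 1 n).filter (fun k => k ≠ 1 ∧ k ≠ 2), solM x 1 k * solM x 2 k)

/-- Sum of a symmetric function over the pairs `i < j` other than `(1, 2)`. -/
lemma sum_pairs_ne_one_two (I : Finset ℕ) (h1 : 1 ∈ I) (h2 : 2 ∈ I) (g : ℕ → ℕ → ℝ)
    (hg : ∀ i j, g i j = g j i) :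
    ∑ i ∈ I, ∑ j ∈ I, (if i < j ∧ ¬(i = 1 ∧ j = 2) then g i j else 0) =
      (∑ i ∈ I, ∑ j ∈ I, g i j - ∑ i ∈ I, g i i) / 2 - g 1 2 := by
  have hsplit : ∑ i ∈ I, ∑ j ∈ I, g i j =
      ∑ i ∈ I, ∑ j ∈ I, (if i < j then g i j else 0) +
        ∑ i ∈ I, ∑ j ∈ I, (if j < i then g i j else 0) +
          ∑ i ∈ I, ∑ j ∈ I, (if i = j then g i j else 0) := by
    simp only [← sum_add_distrib]
    refine sum_congr rfl fun i _ => sum_congr rfl fun j _ => ?_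
    rcases lt_trichotomy i j with h | h | h
    · simp [h, h.not_gt, h.ne]
    · simp [h]
    · simp [h, h.not_gt, h.ne']
  have hswap : ∑ i ∈ I, ∑ j ∈ I, (if j < i then g i j else 0) =
      ∑ i ∈ I, ∑ j ∈ I, (if i < j then g i j else 0) := by
    rw [sum_comm]
    exact sum_congr rfl fun i _ => sum_congr rfl fun j _ => by rw [hg]
  have hdiag : ∑ i ∈ I, ∑ j ∈ I, (if i = j then g i j else 0) = ∑ i ∈ I, g i i :=
    sum_congr rfl fun i hi => by simp [hi]
  have hone : ∑ i ∈ I, ∑ j ∈ I, (if i = 1 then (if j = 2 then g i j else 0) else 0) = g 1 2 := by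
    rw [sum_eq_single_of_mem 1 h1 (fun i _ hi => by simp [hi])]
    simp [h2]
  have hexcl : ∑ i ∈ I, ∑ j ∈ I, (if i < j then g i j else 0) =
      ∑ i ∈ I, ∑ j ∈ I, (if i < j ∧ ¬(i = 1 ∧ j = 2) then g i j else 0) +
        ∑ i ∈ I, ∑ j ∈ I, (if i = 1 then (if j = 2 then g i j else 0) else 0) := by
    simp only [← sum_add_distrib]
    refine sum_congr rfl fun i _ => sum_congr rfl fun j _ => ?_
    by_cases hi : i = 1 <;> by_cases hj : j = 2 <;> simp [hi, hj]
  linarith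

lemma Icc_one_eq_insert {n : ℕ} (hn : 2 ≤ n) : Icc 1 n = insert 1 (insert 2 (Icc 3 n)) := by
  ext k
  simp only [mem_Icc, mem_insert]
  omega

lemma sum_Icc_one {n : ℕ} (hn : 2 ≤ n) (g : ℕ → ℝ) :
    ∑ i ∈ Icc 1 n, g i = g 1 + g 2 + ∑ i ∈ Icc 3 n, g i := by
  rw [Icc_one_eq_insert hn, sum_insert (by simp), sum_insert (by simp), add_assoc]

lemma solS_eq {n : ℕ} (hn : 2 ≤ n) (x : ℕ → ℝ) :
    solS n x = ((n : ℝ) - 2) * (x 1 + x 2) + ((n : ℝ) - 1) * ∑ i ∈ Icc 3 n, x i := by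
  unfold solS solM
  rw [sum_pairs_ne_one_two _ (by simp; omega) (by simp; omega) (fun i j => x i + x j)
    (fun i j => add_comm _ _)]
  simp only [sum_add_distrib, sum_const, Nat.card_Icc, nsmul_eq_mul, ← mul_sum,
    add_tsub_cancel_right]
  rw [sum_Icc_one hn]
  ring

lemma sum_filter_solM {n : ℕ} (x : ℕ → ℝ) {i j : ℕ} (hi : i ∈ Icc 1 n) (hj : j ∈ Icc 1 n)
    (hij : i ≠ j) :
    ∑ k ∈ (Icc 1 n).filter (fun k => k ≠ i ∧ k ≠ j), solM x i k * solM x j k =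
      n * (x i * x j) + (x i + x j) * ∑ k ∈ Icc 1 n, x k + ∑ k ∈ Icc 1 n, x k ^ 2
        - 2 * (x i + x j) ^ 2 := by
  have hset : (Icc 1 n).filter (fun k => k ≠ i ∧ k ≠ j) = ((Icc 1 n).erase i).erase j := by
    ext k
    simp only [mem_filter, mem_erase]
    tauto
  have hfull : ∑ k ∈ Icc 1 n, solM x i k * solM x j k =
      n * (x i * x j) + (x i + x j) * ∑ k ∈ Icc 1 n, x k + ∑ k ∈ Icc 1 n, x k ^ 2 := by
    have hterm : ∀ k, solM x i k * solM x j k = x i * x j + (x i + x j) * x k + x k ^ 2 :=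
      fun k => by unfold solM; ring
    simp only [hterm, sum_add_distrib, sum_const, Nat.card_Icc, nsmul_eq_mul, ← mul_sum,
      add_tsub_cancel_right]
  have hei := add_sum_erase (Icc 1 n) (fun k => solM x i k * solM x j k) hi
  have hej := add_sum_erase ((Icc 1 n).erase i) (fun k => solM x i k * solM x j k)
    (mem_erase.2 ⟨hij.symm, hj⟩)
  rw [hset]
  simp only [hfull] at hei hej
  unfold solM at *
  linear_combination hei + hej

lemma solf_eq {n : ℕ} (hn : 2 ≤ n) (m : ℕ) (x : ℕ → ℝ) {a b N T Q S : ℝ}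
    (ha : x 1 = a) (hb : x 2 = b) (hN : (n : ℝ) = N + 2) (hT : ∑ i ∈ Icc 3 n, x i = T)
    (hQ : ∑ i ∈ Icc 3 n, x i ^ 2 = Q) (hS : solS n x = S) :
    solf n m x = -(S ^ 2 / (m + 1)) - 2 * (a + b) * S
      + (N + 2) * (N + 1) / 2 * (a ^ 2 + b ^ 2 + Q)
      + (3 * N + 2) * (a * b + (a + b) * T + (T ^ 2 - Q) / 2) - (a + b) ^ 2
      + m * (N * (a * b) + (a + b) * T + Q) := by
  have h1 : 1 ∈ Icc 1 n := by simp; omega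
  have h2 : 2 ∈ Icc 1 n := by simp; omega
  have hp := sum_Icc_one hn x
  have hq := sum_Icc_one hn (fun i => x i ^ 2)
  rw [ha, hb, hT] at hp
  simp only [ha, hb, hQ] at hq
  set p := ∑ i ∈ Icc 1 n, x i with hpdef
  set q := ∑ i ∈ Icc 1 n, x i ^ 2 with hqdef
  have hdouble : (∑ i ∈ Icc 1 n, ∑ j ∈ Icc 1 n,
      if i < j ∧ ¬(i = 1 ∧ j = 2) then
        (solM x i j) ^ 2 +
          ∑ k ∈ (Icc 1 n).filter (fun k => k ≠ i ∧ k ≠ j), solM x i k * solM x j k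
      else 0) =
      ∑ i ∈ Icc 1 n, ∑ j ∈ Icc 1 n, if i < j ∧ ¬(i = 1 ∧ j = 2) then
        (n - 2) * (x i * x j) + (x i + x j) * p + q - x i ^ 2 - x j ^ 2 else 0 := by
    refine sum_congr rfl fun i hi => sum_congr rfl fun j hj => ?_
    split_ifs with h
    · rw [sum_filter_solM x hi hj h.1.ne]
      unfold solM
      ring
    · rfl
  unfold solf
  rw [hdouble, sum_pairs_ne_one_two _ h1 h2
    (fun i j => (n - 2) * (x i * x j) + (x i + x j) * p + q - x i ^ 2 - x j ^ 2)
    (fun i j => by ring), sum_filter_solM x h1 h2 (by norm_num)]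
  have hsq : ∀ i, x i * x i = x i ^ 2 := fun i => by ring
  simp only [sum_add_distrib, sum_sub_distrib, sum_const, Nat.card_Icc, nsmul_eq_mul, ← mul_sum,
    ← sum_mul, add_tsub_cancel_right, hsq, ← hpdef, ← hqdef, solM, ha, hb, hS, hN, hp, hq]
  have hm : (m : ℝ) + 1 ≠ 0 := by positivity
  field_simp
  ring

/-- The closed form of `solf` is nonnegative: `t` is the mean and `Q` the sum of squares of the `N`
variables other than `a` and `b`, and `s = -(a + b)`. -/
lemma closed_form_nonneg {N m a b t Q s S : ℝ} (hN : 2 ≤ N) (hm : 1 ≤ m) (hs : s = -(a + b))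
    (hs0 : 0 ≤ s) (hab : a ≤ b) (hbt : b ≤ t) (hQ : N * t ^ 2 ≤ Q)
    (hS : S = -N * s + (N + 1) * (N * t)) (hS1 : (m - 1 / 2) * s ≤ S) (hS2 : S ≤ (m + 1) * s) :
    0 ≤ -(S ^ 2 / (m + 1)) + 2 * s * S
      + (N + 2) * (N + 1) / 2 * (a ^ 2 + b ^ 2 + Q)
      + (3 * N + 2) * (a * b - s * (N * t) + ((N * t) ^ 2 - Q) / 2) - s ^ 2
      + m * (N * (a * b) - s * (N * t) + Q) := by
  have hS0 : 0 ≤ S := le_trans (mul_nonneg (by linarith) hs0) hS1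
  have hdiv : S ^ 2 / (m + 1) ≤ S * s := by
    rw [div_le_iff₀ (by linarith)]
    nlinarith [mul_le_mul_of_nonneg_left hS2 hS0]
  have hQ' : 0 ≤ (N ^ 2 / 2 + m) * (Q - N * t ^ 2) :=
    mul_nonneg (by positivity) (by linarith)
  have ha : a = -s - b := by linarith
  rcases le_total N m with h | h
  · have hprod : 0 ≤ N * (m - N) * (a * b + t * (s + t)) := by
      refine mul_nonneg (mul_nonneg (by linarith) (by linarith)) ?_
      have := mul_nonneg (sub_nonneg.2 hbt) (show 0 ≤ s + t + b by linarith)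
      rw [ha]
      linarith
    have key : 0 ≤ 2 * (S + N * s) * (S + (N - m) * s) - S * (N + 1) * s
        + N * (N ^ 2 - 1) / 2 * s ^ 2 := by
      have e1 : 0 ≤ (S + N * s) * (S - (m - 1 / 2) * s) :=
        mul_nonneg (by positivity) (by linarith)
      have e2 : 0 ≤ (N - 2) * (S * s) := mul_nonneg (by linarith) (by positivity)
      have e3 : 0 ≤ N * (2 * N - 1) * s ^ 2 :=
        mul_nonneg (mul_nonneg (by linarith) (by linarith)) (by positivity)
      have e4 : 0 ≤ N * (N ^ 2 - 1) / 2 * s ^ 2 :=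
        mul_nonneg (div_nonneg (mul_nonneg (by linarith) (by nlinarith)) (by norm_num))
          (by positivity)
      nlinarith
    refine le_of_mul_le_mul_left ?_ (show 0 < N + 1 by linarith)
    have hd := mul_le_mul_of_nonneg_left hdiv (show 0 ≤ N + 1 by linarith)
    have hp := mul_nonneg (show 0 ≤ N + 1 by linarith) (add_nonneg hprod hQ')
    subst hS ha
    linarith
  · have hprod : 0 ≤ N * (N - m) * (s ^ 2 / 4 - a * b) := by
      refine mul_nonneg (mul_nonneg (by linarith) (by linarith)) ?_
      rw [hs]
      linarith [sq_nonneg (a - b)]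
    have key : 0 ≤ N * (N + 2 + m) / 4 * s ^ 2 - (2 * N + 1 + m) * (s * (N * t))
        + (2 * N + 1 + m / N) * (N * t) ^ 2 := by
      have hN0 : N ≠ 0 := by linarith
      set A := 2 * N + 1 + m / N with hA
      have hA0 : 0 < A := by positivity
      have hdisc : (2 * N + 1 + m) ^ 2 ≤ A * (N * (N + 2 + m)) := by
        have : A * (N * (N + 2 + m)) = ((2 * N + 1) * N + m) * (N + 2 + m) := by
          rw [hA]
          field_simp
        rw [this]
        nlinarith [mul_nonneg (show 0 ≤ m by linarith) (sub_nonneg.2 hN),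
          mul_nonneg (mul_nonneg (show 0 ≤ m by linarith) (sub_nonneg.2 hN))
            (show 0 ≤ N by linarith),
          mul_nonneg (show 0 ≤ 2 * N + 1 by linarith) (show 0 ≤ N ^ 2 - 1 by nlinarith)]
      refine le_of_mul_le_mul_left ?_ (show 0 < 4 * A by linarith)
      nlinarith [sq_nonneg (2 * A * (N * t) - (2 * N + 1 + m) * s),
        mul_nonneg (sub_nonneg.2 hdisc) (sq_nonneg s)]
    have hdivN : m / N * (N * t) ^ 2 = m * N * t ^ 2 := by field_simp
    rw [add_mul _ (m / N), hdivN] at key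
    subst hS ha
    linarith

theorem algebra_lemma (n m : ℕ) (hn : 4 ≤ n) (hm : 1 ≤ m) :
    ∃ C : ℝ, 0 ≤ C ∧ ∀ (ρ : ℝ), 0 ≤ ρ → ∀ x : ℕ → ℝ,
      (x 1 ≤ x 2 ∧ ∀ i, 3 ≤ i → i ≤ n → x 2 ≤ x i) →
      solS n x + (m : ℝ) * solM x 1 2 ≥ -ρ →
      solS n x + ((m : ℝ) + 1) * solM x 1 2 <
        -(((m : ℝ) + 1) * ((m : ℝ) + (n : ℝ) - 1)) * ρ →
      solf n m x ≥ -C * ρ ^ 2 := by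
  refine ⟨0, le_rfl, fun ρ hρ x ⟨h12, h2⟩ hlow hup => ?_⟩
  have hn' : (4 : ℝ) ≤ n := by exact_mod_cast hn
  have hm' : (1 : ℝ) ≤ m := by exact_mod_cast hm
  have hcard : (((Icc 3 n).card : ℕ) : ℝ) = (n : ℝ) - 2 := by
    rw [Nat.card_Icc, Nat.cast_sub (by omega)]
    push_cast
    ring
  have hSeq := solS_eq (show 2 ≤ n by omega) x
  have hbT : ((n : ℝ) - 2) * x 2 ≤ ∑ i ∈ Icc 3 n, x i := by
    have := card_nsmul_le_sum (Icc 3 n) x (x 2) fun i hi =>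
      h2 i (mem_Icc.1 hi).1 (mem_Icc.1 hi).2
    rwa [nsmul_eq_mul, hcard] at this
  have hTQ := sq_sum_le_card_mul_sum_sq (s := Icc 3 n) (f := x)
  rw [hcard] at hTQ
  obtain ⟨N, hN⟩ : ∃ N : ℝ, (n : ℝ) = N + 2 := ⟨n - 2, by ring⟩
  have hN2 : 2 ≤ N := by linarith
  obtain ⟨t, ht⟩ : ∃ t : ℝ, ∑ i ∈ Icc 3 n, x i = N * t :=
    ⟨(∑ i ∈ Icc 3 n, x i) / N, by field_simp⟩
  rw [solf_eq (by omega) m x rfl rfl hN ht rfl rfl]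
  rw [ht, hN] at hSeq hbT hTQ
  rw [hN] at hup
  simp only [solM] at hlow hup
  have hK : 8 * ρ ≤ (m + 1) * (m + (N + 2) - 1) * ρ :=
    mul_le_mul_of_nonneg_right (by nlinarith) hρ
  have hσ : 2 * ρ ≤ -(x 1 + x 2) := by linarith
  have := closed_form_nonneg (N := N) (m := m) (a := x 1) (b := x 2) (t := t)
    (Q := ∑ i ∈ Icc 3 n, x i ^ 2) (s := -(x 1 + x 2)) (S := solS n x) hN2 hm' rfl
    (by linarith) h12
    (le_of_mul_le_mul_left (by linarith) (show 0 < N by linarith))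
    (le_of_mul_le_mul_left (by linarith) (show 0 < N by linarith))
    (by rw [hSeq]; ring) (by linarith) (by linarith)
  linarith
end

section
/- Suppose m = 1 or m = 2, x_3 = x_4 = ⋯ = x_n, ρ ≥ 0, and the hypotheses (i) x_1 ≤ x_2 ≤ min_{3≤i≤n} x_i, (ii) S + m·M_{12} ≥ −ρ, (iii) S + (m+1)·M_{12} < −(m+1)(m+n−1)·ρ hold. Then f(x_1, x_2, x_3, …, x_3) ≥ 0. -/
open Finset

/-- A sum over `1, …, N + 2` of a function that is constant on the indices `k ≥ 3`. -/
lemma sum_Icc_of_const_tail (F : ℕ → ℝ) (C : ℝ) (N : ℕ)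
    (hF : ∀ k, 3 ≤ k → k ≤ N + 2 → F k = C) :
    ∑ k ∈ Icc 1 (N + 2), F k = F 1 + F 2 + N * C := by
  induction N with
  | zero => simp [Finset.sum_Icc_succ_top]
  | succ N ih =>
    rw [show N + 1 + 2 = (N + 2) + 1 by ring, Finset.sum_Icc_succ_top (by omega),
      ih fun k h h' => hF k h (by omega), hF (N + 2 + 1) (by omega) (by omega)]
    push_cast
    ring

/-- The sum of `G i j` over the pairs `i < j` other than `(1, 2)`, when `G` depends only on
whether the indices are `1`, `2` or at least `3`. -/
lemma sum_pairs_of_const_tail (G : ℕ → ℕ → ℝ) (A B C : ℝ) (N : ℕ)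
    (hA : ∀ j, 3 ≤ j → j ≤ N + 2 → G 1 j = A) (hB : ∀ j, 3 ≤ j → j ≤ N + 2 → G 2 j = B)
    (hC : ∀ i j, 3 ≤ i → i < j → j ≤ N + 2 → G i j = C) :
    (∑ i ∈ Icc 1 (N + 2), ∑ j ∈ Icc 1 (N + 2),
      if i < j ∧ ¬(i = 1 ∧ j = 2) then G i j else 0) =
      N * A + N * B + N * (N - 1) / 2 * C := by
  induction N with
  | zero => simp [Finset.sum_Icc_succ_top]
  | succ N ih =>
    have last_row : (∑ j ∈ Icc 1 (N + 2 + 1),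
        if N + 2 + 1 < j ∧ ¬(N + 2 + 1 = 1 ∧ j = 2) then G (N + 2 + 1) j else 0) = 0 := by
      refine Finset.sum_eq_zero fun j hj => if_neg ?_
      rw [Finset.mem_Icc] at hj
      omega
    have last_column : (∑ i ∈ Icc 1 (N + 2),
        if i < N + 2 + 1 ∧ ¬(i = 1 ∧ N + 2 + 1 = 2) then G i (N + 2 + 1) else 0) =
        A + B + N * C := by
      rw [sum_Icc_of_const_tail _ C]
      · simp [hA (N + 2 + 1) (by omega) (by omega), hB (N + 2 + 1) (by omega) (by omega)]
      · intro k h h'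
        rw [if_pos (by omega), hC k _ h (by omega) (by omega)]
    rw [show N + 1 + 2 = (N + 2) + 1 by ring, Finset.sum_Icc_succ_top (by omega), last_row]
    simp_rw [Finset.sum_Icc_succ_top (show 1 ≤ N + 2 + 1 by omega)]
    rw [Finset.sum_add_distrib, last_column,
      ih (fun j h h' => hA j h (by omega)) (fun j h h' => hB j h (by omega))
        (fun i j h h' hj => hC i j h h' (by omega))]
    push_cast
    ring

lemma sum_Icc_filter_ne_ne (F : ℕ → ℝ) {n i j : ℕ} (hi : i ∈ Icc 1 n) (hj : j ∈ Icc 1 n)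
    (hij : i ≠ j) :
    ∑ k ∈ (Icc 1 n).filter (fun k => k ≠ i ∧ k ≠ j), F k = ∑ k ∈ Icc 1 n, F k - F i - F j := by
  have h : (Icc 1 n).filter (fun k => k ≠ i ∧ k ≠ j) = ((Icc 1 n).erase i).erase j := by
    ext k
    simp only [mem_filter, mem_erase]
    tauto
  rw [h, Finset.sum_erase_eq_sub (mem_erase.2 ⟨hij.symm, hj⟩), Finset.sum_erase_eq_sub hi]

lemma solS_of_const_tail (N : ℕ) (x : ℕ → ℝ) (c : ℝ)
    (hx : ∀ i, 3 ≤ i → i ≤ N + 2 → x i = c) :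
    solS (N + 2) x = N * (x 1 + x 2 + (N + 1) * c) := by
  rw [solS, sum_pairs_of_const_tail _ (x 1 + c) (x 2 + c) (c + c)]
  · ring
  · intro j h h'
    rw [solM, hx j h h']
  · intro j h h'
    rw [solM, hx j h h']
  · intro i j h h' hj
    rw [solM, hx i h (by omega), hx j (by omega) hj]

lemma solf_of_const_tail (N m : ℕ) (x : ℕ → ℝ) (c : ℝ)
    (hx : ∀ i, 3 ≤ i → i ≤ N + 2 → x i = c) :
    solf (N + 2) m x =
      N * (((N + m - 2) / 4 - N / (m + 1)) * (x 1 + x 2) ^ 2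
        + (N + m - 2 * N * (N + 1) / (m + 1)) * (x 1 + x 2) * c
        + (2 * N ^ 2 + N + m - N * (N + 1) ^ 2 / (m + 1)) * c ^ 2)
      + N * (N - m) * ((x 2 - x 1) / 2) ^ 2 := by
  have hM : ∀ i j, 1 ≤ i → i < j → j ≤ N + 2 →
      ∑ k ∈ (Icc 1 (N + 2)).filter (fun k => k ≠ i ∧ k ≠ j), solM x i k * solM x j k =
        (x i + x 1) * (x j + x 1) + (x i + x 2) * (x j + x 2) + N * ((x i + c) * (x j + c))
          - (x i + x i) * (x j + x i) - (x i + x j) * (x j + x j) := by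
    intro i j h h' hj
    rw [sum_Icc_filter_ne_ne _ (mem_Icc.2 ⟨h, by omega⟩) (mem_Icc.2 ⟨by omega, hj⟩) h'.ne,
      sum_Icc_of_const_tail _ ((x i + c) * (x j + c))]
    · simp only [solM]
    · intro k hk hk'
      simp only [solM, hx k hk hk']
  have hm : (m : ℝ) + 1 ≠ 0 := by positivity
  rw [solf, solS_of_const_tail N x c hx, hM 1 2 (by omega) (by omega) (by omega),
    sum_pairs_of_const_tail _
      ((x 1 + c) ^ 2 + ((x 1 + x 2) * (c + x 2) + (N - 1) * ((x 1 + c) * (c + c))))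
      ((x 2 + c) ^ 2 + ((x 2 + x 1) * (c + x 1) + (N - 1) * ((x 2 + c) * (c + c))))
      ((c + c) ^ 2 + ((c + x 1) ^ 2 + (c + x 2) ^ 2 + (N - 2) * (c + c) ^ 2))]
  · simp only [solM]
    field_simp
    ring
  · intro j h h'
    rw [hM 1 j (by omega) (by omega) h', solM, hx j h h']
    ring
  · intro j h h'
    rw [hM 2 j (by omega) (by omega) h', solM, hx j h h']
    ring
  · intro i j h h' hj
    rw [hM i j (by omega) h' hj, solM, hx i h (by omega), hx j (by omega) hj]
    ring

/-- A binary quadratic form with nonnegative coefficients is nonnegative at `(u, w)` when `u` is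
not too negative compared with `w`. -/
lemma quadratic_form_nonneg {A B C K ρ u w : ℝ} (hA : 0 ≤ A) (hB : 0 ≤ B) (hK : 0 < K)
    (hBC : B ≤ K * C) (hρ : 0 ≤ ρ) (hu : -ρ ≤ u) (hw : K * ρ ≤ w) :
    0 ≤ A * u ^ 2 + B * u * w + C * w ^ 2 := by
  have hw0 : 0 ≤ w := (by positivity : 0 ≤ K * ρ).trans hw
  have huw : 0 ≤ K * u + w := by nlinarith
  have h1 : 0 ≤ B * w * (K * u + w) := by positivity
  have h2 : 0 ≤ (K * C - B) * w ^ 2 := mul_nonneg (sub_nonneg.2 hBC) (sq_nonneg w)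
  have h3 : 0 ≤ K * (A * u ^ 2) := by positivity
  refine nonneg_of_mul_nonneg_right (a := K) ?_ hK
  linarith

/-- The reduced quadratic form in `p = x₁ + x₂` and `c`, after the change of variables
`u = S + m p`, `w = -(S + (m + 1) p)`. -/
lemma reduced_form_nonneg {N m α β γ K ρ p c : ℝ} (hN : 0 < N) (hK : 0 < K)
    (hA : 0 ≤ α * (N * (N + 1)) ^ 2 - β * (N * (N + 1)) * (N + m + 1) + γ * (N + m + 1) ^ 2)
    (hB : 0 ≤ 2 * α * (N * (N + 1)) ^ 2 - β * (N * (N + 1)) * (2 * N + 2 * m + 1)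
      + 2 * γ * (N + m + 1) * (N + m))
    (hBC : 2 * α * (N * (N + 1)) ^ 2 - β * (N * (N + 1)) * (2 * N + 2 * m + 1)
      + 2 * γ * (N + m + 1) * (N + m) ≤
      K * (α * (N * (N + 1)) ^ 2 - β * (N * (N + 1)) * (N + m) + γ * (N + m) ^ 2))
    (hρ : 0 ≤ ρ) (hu : -ρ ≤ N * (p + (N + 1) * c) + m * p)
    (hw : K * ρ ≤ -(N * (p + (N + 1) * c) + (m + 1) * p)) :
    0 ≤ α * p ^ 2 + β * p * c + γ * c ^ 2 := by
  have h := quadratic_form_nonneg hA hB hK hBC hρ hu hw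
  refine nonneg_of_mul_nonneg_right (a := (N * (N + 1)) ^ 2) ?_ (by positivity)
  linear_combination h

/-- Case 1 of the algebra lemma: `m = 1` or `m = 2`. -/
theorem case_m_one_or_two (n m : ℕ) (hn : 4 ≤ n) (hm : m = 1 ∨ m = 2) (ρ : ℝ) (hρ : 0 ≤ ρ)
    (x : ℕ → ℝ)
    (hx : ∀ i, 3 ≤ i → i ≤ n → x i = x 3)
    (h1 : x 1 ≤ x 2 ∧ ∀ i, 3 ≤ i → i ≤ n → x 2 ≤ x i)
    (h2 : solS n x + (m : ℝ) * solM x 1 2 ≥ -ρ)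
    (h3 : solS n x + ((m : ℝ) + 1) * solM x 1 2 <
      -(((m : ℝ) + 1) * ((m : ℝ) + (n : ℝ) - 1)) * ρ) :
    solf n m x ≥ 0 := by
  obtain ⟨N, rfl⟩ : ∃ N, n = N + 2 := ⟨n - 2, by omega⟩
  obtain ⟨k, rfl⟩ : ∃ k, N = k + 2 := ⟨N - 2, by omega⟩
  rw [solS_of_const_tail _ x (x 3) hx, solM] at h2 h3
  rw [solf_of_const_tail _ m x (x 3) hx]
  have hk : (0 : ℝ) ≤ k := k.cast_nonneg
  refine add_nonneg (mul_nonneg (Nat.cast_nonneg _) ?_) (mul_nonneg (mul_nonneg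
    (Nat.cast_nonneg _) ?_) (sq_nonneg _))
  · push_cast at h2 h3 ⊢
    refine reduced_form_nonneg (N := k + 2) (m := m) (K := (m + 1) * (m + k + 3)) (ρ := ρ)
      (by positivity) (by positivity) ?_ ?_ ?_ hρ h2 (by linarith)
    · rcases hm with rfl | rfl <;> push_cast <;> ring_nf <;> positivity
    · rcases hm with rfl | rfl <;> push_cast <;> ring_nf <;> positivity
    · rw [← sub_nonneg]
      rcases hm with rfl | rfl <;> push_cast <;> ring_nf <;> positivity
  · rcases hm with rfl | rfl <;> push_cast <;> linarith
end

section
/- Suppose x_3 = x_4 = ⋯ = x_n, ρ ≥ 0, M_{13}·M_{23} ≥ 0, and the hypotheses (i) x_1 ≤ x_2 ≤ min_{3≤i≤n} x_i, (ii) S + m·M_{12} ≥ −ρ, (iii) S + (m+1)·M_{12} < −(m+1)(m+n−1)·ρ hold. Then f(x_1, x_2, x_3, …, x_3) ≥ 0. -/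
open Finset

/-- Split off the first two terms of a sum which is constant from index `3` on. -/
theorem sum_Icc_one_eq_of_const {n : ℕ} (hn : 2 ≤ n) (g : ℕ → ℝ) (v : ℝ)
    (hg : ∀ k, 3 ≤ k → k ≤ n → g k = v) :
    ∑ k ∈ Icc 1 n, g k = g 1 + g 2 + ((n : ℝ) - 2) * v := by
  induction n, hn using Nat.le_induction with
  | base => simp [Finset.sum_Icc_succ_top]
  | succ k hk ih =>
    rw [Finset.sum_Icc_succ_top (by omega), ih fun j h₁ h₂ => hg j h₁ (by omega),
      hg (k + 1) (by omega) le_rfl]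
    push_cast
    ring

/-- A sum over pairs `i < j` other than `(1, 2)` whose summand takes one value on the pairs
`(1, k)`, one on the pairs `(2, k)` and one on the remaining pairs. -/
theorem sum_pairs_eq_of_const {n : ℕ} (hn : 2 ≤ n) (F : ℕ → ℕ → ℝ) (P Q R : ℝ)
    (h1 : ∀ k, 3 ≤ k → k ≤ n → F 1 k = P) (h2 : ∀ k, 3 ≤ k → k ≤ n → F 2 k = Q)
    (h3 : ∀ i j, 3 ≤ i → i < j → j ≤ n → F i j = R) :
    (∑ i ∈ Icc 1 n, ∑ j ∈ Icc 1 n, if i < j ∧ ¬(i = 1 ∧ j = 2) then F i j else 0)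
      = ((n : ℝ) - 2) * (P + Q) + ((n : ℝ) - 2) * ((n : ℝ) - 3) / 2 * R := by
  induction n, hn using Nat.le_induction with
  | base => simp [Finset.sum_Icc_succ_top]
  | succ k hk ih =>
    have ih' := ih (fun j a b => h1 j a (by omega)) (fun j a b => h2 j a (by omega))
      (fun i j a b c => h3 i j a b (by omega))
    have hlast : ∑ j ∈ Icc 1 (k + 1),
        (if k + 1 < j ∧ ¬(k + 1 = 1 ∧ j = 2) then F (k + 1) j else 0) = 0 :=
      Finset.sum_eq_zero fun j hj => if_neg (by simp only [Finset.mem_Icc] at hj; omega)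
    have hcol : ∑ i ∈ Icc 1 k,
        (if i < k + 1 ∧ ¬(i = 1 ∧ k + 1 = 2) then F i (k + 1) else 0)
          = P + Q + ((k : ℝ) - 2) * R := by
      rw [sum_Icc_one_eq_of_const hk _ R, if_pos (by omega), if_pos (by omega),
        h1 _ (by omega) le_rfl, h2 _ (by omega) le_rfl]
      intro i hi hik
      rw [if_pos (by omega), h3 i _ hi (by omega) le_rfl]
    rw [Finset.sum_Icc_succ_top (by omega), hlast,
      Finset.sum_congr rfl fun i _ => Finset.sum_Icc_succ_top (by omega) _,
      Finset.sum_add_distrib, ih', hcol]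
    push_cast
    ring

/-- Removing two distinct indices from a finite sum. -/
theorem sum_filter_ne_ne {s : Finset ℕ} {i j : ℕ} (hi : i ∈ s) (hj : j ∈ s) (hij : i ≠ j)
    (g : ℕ → ℝ) :
    ∑ k ∈ s.filter (fun k => k ≠ i ∧ k ≠ j), g k = ∑ k ∈ s, g k - g i - g j := by
  have hs : s.filter (fun k => k ≠ i ∧ k ≠ j) = (s.erase i).erase j := by
    ext k
    simp only [Finset.mem_filter, Finset.mem_erase]
    tauto
  rw [hs, ← Finset.add_sum_erase s g hi,
    ← Finset.add_sum_erase (s.erase i) g (Finset.mem_erase.2 ⟨hij.symm, hj⟩)]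
  ring

theorem solS_eq_of_const {n : ℕ} (hn : 3 ≤ n) (x : ℕ → ℝ)
    (hx : ∀ i, 3 ≤ i → i ≤ n → x i = x 3) :
    solS n x = ((n : ℝ) - 2) * (solM x 1 3 + solM x 2 3)
      + ((n : ℝ) - 2) * ((n : ℝ) - 3) / 2 * solM x 3 3 := by
  refine sum_pairs_eq_of_const (by omega) _ _ _ _ ?_ ?_ ?_
  · intro k h h'
    simp only [solM, hx k h h']
  · intro k h h'
    simp only [solM, hx k h h']
  · intro i j h h' h''
    simp only [solM, hx i h (by omega), hx j (by omega) h'']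

theorem sum_solM_mul_solM_of_const {n : ℕ} (hn : 3 ≤ n) (x : ℕ → ℝ)
    (hx : ∀ i, 3 ≤ i → i ≤ n → x i = x 3) {i j : ℕ} (hi : i ∈ Icc 1 n) (hj : j ∈ Icc 1 n)
    (hij : i ≠ j) :
    ∑ k ∈ (Icc 1 n).filter (fun k => k ≠ i ∧ k ≠ j), solM x i k * solM x j k
      = solM x i 1 * solM x j 1 + solM x i 2 * solM x j 2
        + ((n : ℝ) - 2) * (solM x i 3 * solM x j 3)
        - solM x i i * solM x j i - solM x i j * solM x j j := by
  rw [sum_filter_ne_ne hi hj hij, sum_Icc_one_eq_of_const (by omega)]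
  intro k h h'
  simp only [solM, hx k h h']

theorem solf_eq_of_const {n : ℕ} (hn : 3 ≤ n) (m : ℕ) (x : ℕ → ℝ)
    (hx : ∀ i, 3 ≤ i → i ≤ n → x i = x 3) :
    solf n m x = -(solS n x / ((m : ℝ) + 1)) * (solS n x + ((m : ℝ) + 1) * solM x 1 2)
      - solM x 1 2 * solS n x
      + (((n : ℝ) - 2) * (solM x 1 3 ^ 2 + solM x 2 3 ^ 2
            + solM x 1 2 * (solM x 1 3 + solM x 2 3)
            + ((n : ℝ) - 3) * (solM x 1 3 + solM x 2 3) * solM x 3 3)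
          + ((n : ℝ) - 2) * ((n : ℝ) - 3) / 2
            * (((n : ℝ) - 3) * solM x 3 3 ^ 2 + solM x 1 3 ^ 2 + solM x 2 3 ^ 2)
        + ((m : ℝ) + 1) * (((n : ℝ) - 2) * (solM x 1 3 * solM x 2 3))) := by
  unfold solf
  rw [sum_pairs_eq_of_const (by omega) _
      (solM x 1 3 ^ 2 + solM x 1 2 * solM x 2 3 + ((n : ℝ) - 3) * solM x 1 3 * solM x 3 3)
      (solM x 2 3 ^ 2 + solM x 1 2 * solM x 1 3 + ((n : ℝ) - 3) * solM x 2 3 * solM x 3 3)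
      (((n : ℝ) - 3) * solM x 3 3 ^ 2 + solM x 1 3 ^ 2 + solM x 2 3 ^ 2),
    sum_solM_mul_solM_of_const hn x hx (by simp; omega) (by simp; omega) (by decide)]
  · simp only [solM]
    ring
  · intro k h h'
    rw [sum_solM_mul_solM_of_const hn x hx (by simp; omega) (by simp; omega) (by omega)]
    simp only [solM, hx k h h']
    ring
  · intro k h h'
    rw [sum_solM_mul_solM_of_const hn x hx (by simp; omega) (by simp; omega) (by omega)]
    simp only [solM, hx k h h']
    ring
  · intro i j h h' h''
    rw [sum_solM_mul_solM_of_const hn x hx (by simp; omega) (by simp; omega) (by omega)]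
    simp only [solM, hx i h (by omega), hx j (by omega) h'']
    ring

/-- The part of `f` that remains after discarding the nonnegative terms containing `m`; here `p`,
`q`, `r` stand for `M_{13}`, `M_{23}`, `M_{33}`, and `N = n - 2`. -/
theorem reduced_form_nonneg_s6 {N p q r : ℝ} (hN : 1 ≤ N) :
    0 ≤ -(p + q - r) * (N * (p + q) + N * (N - 1) / 2 * r)
      + (N * (p ^ 2 + q ^ 2 + (p + q - r) * (p + q) + (N - 1) * (p + q) * r)
        + N * (N - 1) / 2 * ((N - 1) * r ^ 2 + p ^ 2 + q ^ 2)) := by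
  have hN0 : 0 ≤ N := by linarith
  have hN1 : 0 ≤ N - 1 := by linarith
  have hC : 0 ≤ N * (N - 1) := mul_nonneg hN0 hN1
  have hid : -(p + q - r) * (N * (p + q) + N * (N - 1) / 2 * r)
      + (N * (p ^ 2 + q ^ 2 + (p + q - r) * (p + q) + (N - 1) * (p + q) * r)
        + N * (N - 1) / 2 * ((N - 1) * r ^ 2 + p ^ 2 + q ^ 2))
      = N * (p ^ 2 + q ^ 2)
        + N * (N - 1) / 2 * (N * r ^ 2 + (p + q) * r + p ^ 2 + q ^ 2) := by ring
  have hquad : 0 ≤ N * r ^ 2 + (p + q) * r + p ^ 2 + q ^ 2 := by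
    nlinarith [sq_nonneg (p + r / 2), sq_nonneg (q + r / 2), mul_nonneg hN1 (sq_nonneg r),
      sq_nonneg r]
  rw [hid]
  positivity

/-- If `M_{13} M_{23} ≥ 0` then `f ≥ 0`. -/
theorem case_product_nonneg (n m : ℕ) (hn : 4 ≤ n) (hm : 1 ≤ m) (ρ : ℝ) (hρ : 0 ≤ ρ)
    (x : ℕ → ℝ)
    (hx : ∀ i, 3 ≤ i → i ≤ n → x i = x 3)
    (hM : solM x 1 3 * solM x 2 3 ≥ 0)
    (h1 : x 1 ≤ x 2 ∧ ∀ i, 3 ≤ i → i ≤ n → x 2 ≤ x i)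
    (h2 : solS n x + (m : ℝ) * solM x 1 2 ≥ -ρ)
    (h3 : solS n x + ((m : ℝ) + 1) * solM x 1 2 <
      -(((m : ℝ) + 1) * ((m : ℝ) + (n : ℝ) - 1)) * ρ) :
    solf n m x ≥ 0 := by
  rw [solf_eq_of_const (by omega) m x hx]
  have hS := solS_eq_of_const (by omega) x hx
  have hn' : (4 : ℝ) ≤ n := by exact_mod_cast hn
  have hm' : (1 : ℝ) ≤ m := by exact_mod_cast hm
  have hw : solM x 1 2 = solM x 1 3 + solM x 2 3 - solM x 3 3 := by
    simp only [solM]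
    ring
  have hρw : 3 * ρ ≤ -solM x 1 2 := by
    nlinarith [mul_nonneg hρ (sub_nonneg.2 hm'),
      mul_nonneg (mul_nonneg hρ (sub_nonneg.2 hm')) (sub_nonneg.2 hm'),
      mul_nonneg hρ (sub_nonneg.2 hn'),
      mul_nonneg (mul_nonneg hρ (sub_nonneg.2 hm')) (sub_nonneg.2 hn')]
  have hw0 : solM x 1 2 ≤ 0 := by linarith
  have hS0 : 0 ≤ solS n x := by
    nlinarith [mul_nonneg (sub_nonneg.2 hm') (neg_nonneg.2 hw0)]
  have hneg : solS n x + ((m : ℝ) + 1) * solM x 1 2 ≤ 0 := by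
    have : 0 ≤ ((m : ℝ) + 1) * ((m : ℝ) + n - 1) * ρ :=
      mul_nonneg (mul_nonneg (by linarith) (by linarith)) hρ
    linarith
  have hlead : 0 ≤ -(solS n x / ((m : ℝ) + 1))
      * (solS n x + ((m : ℝ) + 1) * solM x 1 2) :=
    mul_nonneg_of_nonpos_of_nonpos (neg_nonpos.2 (by positivity)) hneg
  have hprod : 0 ≤ ((m : ℝ) + 1) * (((n : ℝ) - 2) * (solM x 1 3 * solM x 2 3)) :=
    mul_nonneg (by linarith) (mul_nonneg (by linarith) hM)
  have hrest := reduced_form_nonneg_s6 (N := (n : ℝ) - 2) (p := solM x 1 3) (q := solM x 2 3)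
    (r := solM x 3 3) (by linarith)
  rw [← hw, show (n : ℝ) - 2 - 1 = n - 3 by ring, ← hS] at hrest
  linarith
end

section
/- Let T > 0, c > 0, K > 0, and let u : [0, T] → ℝ be differentiable with u(0) < 0. Suppose that for every t ∈ [0, T] with u(t) ≤ −K one has u'(t) ≥ c·u(t)². Then for every t ∈ [0, T], u(t) ≥ min( 1/(1/u(0) − c·t), −K ). (Note that 1/u(0) − c·t < 0 since u(0) < 0, so the first quantity in the minimum is negative.) -/
/-- The Riccati-type integration step: if `u(0) < 0` and `u' ≥ c u²` whenever `u ≤ -K`,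
then `u(t) ≥ min (1/(1/u(0) - c t)) (-K)` on `[0, T]`. -/
theorem riccati_integration (T c K : ℝ) (hT : 0 < T) (hc : 0 < c) (hK : 0 < K)
    (u : ℝ → ℝ) (hu0 : u 0 < 0)
    (hdiff : ∀ t ∈ Set.Icc (0 : ℝ) T, HasDerivAt u (deriv u t) t)
    (hode : ∀ t ∈ Set.Icc (0 : ℝ) T, u t ≤ -K → deriv u t ≥ c * (u t) ^ 2) :
    ∀ t ∈ Set.Icc (0 : ℝ) T, u t ≥ min (1 / (1 / u 0 - c * t)) (-K) := by
  intro t ht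
  rcases le_or_gt (-K) (u t) with h | h
  · exact (min_le_right _ _).trans h
  refine (min_le_left _ _).trans ?_
  -- The region `u ≥ -K` is forward invariant, so `u < -K` on all of `[0, t]`.
  have hlt : ∀ s ∈ Set.Icc (0 : ℝ) t, u s < -K := by
    intro s hs
    by_contra! hsK
    have hsub : ∀ x ∈ Set.Icc s t, x ∈ Set.Icc (0 : ℝ) T := fun x hx =>
      ⟨hs.1.trans hx.1, hx.2.trans ht.2⟩
    have hbound := image_le_of_deriv_right_lt_deriv_boundary
      (f := fun x => -u x) (f' := fun x => -deriv u x) (a := s) (b := t)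
      (B := fun _ => K) (B' := fun _ => 0)
      (fun x hx => (hdiff x (hsub x hx)).neg.continuousAt.continuousWithinAt)
      (fun x hx => (hdiff x (hsub x (Set.Ico_subset_Icc_self hx))).neg.hasDerivWithinAt)
      (by linarith) (fun x => hasDerivAt_const x K)
      (fun x hx hxK => by
        have hx' := hode x (hsub x (Set.Ico_subset_Icc_self hx)) (by linarith)
        have hxu : u x = -K := by linarith
        rw [hxu] at hx'
        have : 0 < c * (-K) ^ 2 := by rw [neg_sq]; positivity
        linarith)
      (Set.right_mem_Icc.2 hs.2)
    linarith
  have hderiv : ∀ s ∈ Set.Icc (0 : ℝ) t,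
      HasDerivAt (fun x => (u x)⁻¹ + c * x) (-deriv u s / u s ^ 2 + c * 1) s := fun s hs =>
    ((hdiff s ⟨hs.1, hs.2.trans ht.2⟩).fun_inv (by linarith [hlt s hs])).add
      ((hasDerivAt_id s).const_mul c)
  have hanti : AntitoneOn (fun x => (u x)⁻¹ + c * x) (Set.Icc 0 t) := by
    refine antitoneOn_of_deriv_nonpos (convex_Icc 0 t)
      (fun s hs => (hderiv s hs).continuousAt.continuousWithinAt)
      (fun s hs => (hderiv s (interior_subset hs)).differentiableAt.differentiableWithinAt)
      fun s hs => ?_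
    have hs := interior_subset hs
    rw [(hderiv s hs).deriv]
    have hpos : 0 < u s ^ 2 := sq_pos_of_neg (by linarith [hlt s hs])
    have hle : c ≤ deriv u s / u s ^ 2 :=
      (le_div_iff₀ hpos).2 (hode s ⟨hs.1, hs.2.trans ht.2⟩ (hlt s hs).le)
    rw [neg_div]
    linarith
  have hle : (u t)⁻¹ + c * t ≤ (u 0)⁻¹ + c * 0 :=
    hanti (Set.left_mem_Icc.2 ht.1) (Set.right_mem_Icc.2 ht.1) ht.1
  have hneg : 1 / u 0 - c * t < 0 := by
    have := one_div_neg.2 hu0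
    have := mul_nonneg hc.le ht.1
    linarith
  rw [one_div_le_of_neg hneg (by linarith)]
  simp only [one_div]
  linarith
end
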